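/- Fix N ≥ 1, 0 < b < min{2,N}, p > 1, and let u be a classical Schwartz solution of (INLS) on an interval J. Then t ↦ ∫_{ℝ^N} |x|² |u(t,x)|² dx is twice differentiable on J and (d²/dt²) ∫_{ℝ^N} |x|² |u(t,x)|² dx = 8 K(u(t,·)) for all t ∈ J. -/

import Mathlib

open MeasureTheory Set
open scoped BigOperators

noncomputable section

/-- The Laplacian of a complex-valued function on `ℝ^N`, computed as the sum of the repeated
directional derivatives along the standard basis vectors. -/
def lap {N : ℕ} (f : EuclideanSpace ℝ (Fin N) → ℂ) (x : EuclideanSpace ℝ (Fin N)) : ℂ :=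
  ∑ i : Fin N, fderiv ℝ (fun y => fderiv ℝ f y (EuclideanSpace.single i 1)) x
      (EuclideanSpace.single i 1)

/-- The squared euclidean norm `|∇f(x)|²` of the gradient of `f : ℝ^N → ℂ` at `x`. -/
def gradNormSq {N : ℕ} (f : EuclideanSpace ℝ (Fin N) → ℂ) (x : EuclideanSpace ℝ (Fin N)) : ℝ :=
  ∑ i : Fin N, ‖fderiv ℝ f x (EuclideanSpace.single i 1)‖ ^ 2

/-- A classical Schwartz solution of the inhomogeneous nonlinear Schrödinger equation
`i ∂ₜ u + Δu + |x|^{-b} |u|^{p-1} u = 0` on a time interval `J`: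
for each time `t` the spatial profile `u t` is a Schwartz function, `u` is jointly
continuous on `J × ℝ^N`, jointly smooth on `J × (ℝ^N \ {0})`, the Schwartz seminorms of
`u t` are bounded uniformly for `t` in compact subsets of `J`, and the equation holds for
all `t ∈ J` and `x ≠ 0`. -/
structure INLSSolution (N : ℕ) (b p : ℝ) (J : Set ℝ) where
  u : ℝ → SchwartzMap (EuclideanSpace ℝ (Fin N)) ℂ
  cont : ContinuousOn (fun q : ℝ × EuclideanSpace ℝ (Fin N) => u q.1 q.2) (J ×ˢ univ)
  smooth : ContDiffOn ℝ (⊤ : ℕ∞) (fun q : ℝ × EuclideanSpace ℝ (Fin N) => u q.1 q.2)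
      (J ×ˢ {x : EuclideanSpace ℝ (Fin N) | x ≠ 0})
  seminorm_bound : ∀ K : Set ℝ, K ⊆ J → IsCompact K → ∀ k n : ℕ,
      ∃ C : ℝ, ∀ t ∈ K, SchwartzMap.seminorm ℝ k n (u t) ≤ C
  eqn : ∀ t ∈ J, ∀ x : EuclideanSpace ℝ (Fin N), x ≠ 0 → ∃ ut' : ℂ,
      HasDerivWithinAt (fun s => u s x) ut' J t ∧
      Complex.I * ut' + lap (fun y => u t y) x +
        ((‖x‖ ^ (-b) * ‖u t x‖ ^ (p - 1) : ℝ) : ℂ) * u t x = 0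

/-- The Laplacian of a real-valued function on `ℝ^N`, computed as the sum of the repeated
directional derivatives along the standard basis vectors. -/
def lapR {N : ℕ} (f : EuclideanSpace ℝ (Fin N) → ℝ) (x : EuclideanSpace ℝ (Fin N)) : ℝ :=
  ∑ i : Fin N, fderiv ℝ (fun y => fderiv ℝ f y (EuclideanSpace.single i 1)) x
      (EuclideanSpace.single i 1)

/-- The virial functional `K(v) = ∫|∇v|² dx − ((N(p−1)+2b)/(2(p+1))) ∫ |x|^{-b}|v|^{p+1} dx`. -/
def Kq (N : ℕ) (b p : ℝ) (v : EuclideanSpace ℝ (Fin N) → ℂ) : ℝ :=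
  (∫ x : EuclideanSpace ℝ (Fin N), gradNormSq v x) -
    (((N : ℝ) * (p - 1) + 2 * b) / (2 * (p + 1))) *
      ∫ x : EuclideanSpace ℝ (Fin N), ‖x‖ ^ (-b) * ‖v x‖ ^ (p + 1)

section SchwartzIdentities

open scoped SchwartzMap

variable {N : ℕ} {E : Type*} [NormedAddCommGroup E] [NormedSpace ℝ E]
  {F : Type*} [NormedAddCommGroup F] [NormedSpace ℝ F]

/-- The radial derivative `x ↦ x · ∇v(x)` of a Schwartz function, as a Schwartz function. -/
def eulerDeriv (v : 𝓢(E, F)) : 𝓢(E, F) :=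
  SchwartzMap.bilinLeftCLM (ContinuousLinearMap.id ℝ (E →L[ℝ] F)) Function.HasTemperateGrowth.id'
    (SchwartzMap.fderivCLM ℝ E F v)

theorem eulerDeriv_apply (v : 𝓢(E, F)) (x : E) : eulerDeriv v x = fderiv ℝ v x x := rfl

/-- The directional derivative of a Schwartz function, as a Schwartz function. -/
def dirDeriv (e : E) (v : 𝓢(E, F)) : 𝓢(E, F) :=
  SchwartzMap.evalCLM ℝ E F e (SchwartzMap.fderivCLM ℝ E F v)

theorem dirDeriv_apply (e : E) (v : 𝓢(E, F)) (x : E) : dirDeriv e v x = fderiv ℝ v x e := rfl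

/-- The real inner product on `ℂ` as a continuous bilinear map. -/
def innerBilin : ℂ →L[ℝ] ℂ →L[ℝ] ℝ := innerSL ℝ

theorem innerBilin_apply (z w : ℂ) : innerBilin z w = inner ℝ z w := rfl

theorem dirDeriv_eulerDeriv (e : E) (v : 𝓢(E, ℂ)) (x : E) :
    dirDeriv e (eulerDeriv v) x = dirDeriv e v x + eulerDeriv (dirDeriv e v) x := by
  have h2 : ∀ x, HasFDerivAt (fderiv ℝ v) (fderiv ℝ (fderiv ℝ v) x) x := fun x =>
    (SchwartzMap.fderivCLM ℝ E ℂ v).hasFDerivAt x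
  have h1 : HasFDerivAt (eulerDeriv v) _ x := (h2 x).clm_apply (hasFDerivAt_id x)
  have h3 : HasFDerivAt (dirDeriv e v) _ x := (h2 x).clm_apply (hasFDerivAt_const e x)
  have hs : IsSymmSndFDerivAt ℝ v x :=
    (v.smooth 2).contDiffAt.isSymmSndFDerivAt (by simp)
  rw [dirDeriv_apply e (eulerDeriv v), eulerDeriv_apply (dirDeriv e v), h1.fderiv, h3.fderiv,
    dirDeriv_apply]
  simp [hs.eq x e]

section Integrals

variable [MeasurableSpace E] [BorelSpace E] [FiniteDimensional ℝ E] {μ : Measure E}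
  [μ.IsAddHaarMeasure]

theorem integrable_inner_schwartz (v w : 𝓢(E, ℂ)) :
    Integrable (fun x => inner ℝ (v x) (w x)) μ :=
  (SchwartzMap.pairing innerBilin v w).integrable

theorem integral_inner_dirDeriv_left (e : E) (v w : 𝓢(E, ℂ)) :
    ∫ x, inner ℝ (dirDeriv e v x) (w x) ∂μ = -∫ x, inner ℝ (v x) (dirDeriv e w x) ∂μ := by
  have := SchwartzMap.integral_bilinear_lineDerivOp_right_eq_neg_left (μ := μ) v w innerBilin e
  simp only [innerBilin_apply, SchwartzMap.lineDerivOp_apply_eq_fderiv] at this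
  simp only [dirDeriv_apply]
  rw [this, neg_neg]

end Integrals

end SchwartzIdentities

section SingularWeights

open Module (finrank)

variable {ι : Type*} {E : Type*} [NormedAddCommGroup E] {F : Type*} [NormedAddCommGroup F]
  {G : Type*} [NormedAddCommGroup G]

/-- A family of functions indexed by `s` decays rapidly if it is `O(‖x‖ ^ (-m))` for every `m`,
uniformly in the index and in `x`. -/
def RapidDecay (s : Set ι) (f : ι → E → F) : Prop :=
  ∀ m : ℕ, ∃ C : ℝ, ∀ t ∈ s, ∀ x, ‖x‖ ^ m * ‖f t x‖ ≤ C

theorem RapidDecay.exists_bound {s : Set ι} {f : ι → E → F} (hf : RapidDecay s f) (m : ℕ) :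
    ∃ C : ℝ, 0 ≤ C ∧ ∀ t ∈ s, ∀ x, ‖f t x‖ ≤ C * (1 + ‖x‖ ^ m)⁻¹ := by
  obtain ⟨C₀, h₀⟩ := hf 0
  obtain ⟨C₁, h₁⟩ := hf m
  refine ⟨max (C₀ + C₁) 0, le_max_right _ _, fun t ht x => ?_⟩
  rw [← div_eq_mul_inv, le_div_iff₀ (by positivity)]
  have h2 := h₀ t ht x
  have h3 := h₁ t ht x
  refine le_trans ?_ (le_max_left _ _)
  simp only [pow_zero, one_mul] at h2
  linarith

theorem RapidDecay.of_norm_le {s : Set ι} {f : ι → E → F} {g : ι → E → G} (hf : RapidDecay s f)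
    (c : ℝ) (k : ℕ) (h : ∀ t ∈ s, ∀ x, ‖g t x‖ ≤ c * (‖x‖ ^ k * ‖f t x‖)) :
    RapidDecay s g := by
  intro m
  obtain ⟨C, hC⟩ := hf (m + k)
  refine ⟨|c| * C, fun t ht x => ?_⟩
  calc ‖x‖ ^ m * ‖g t x‖ ≤ ‖x‖ ^ m * (|c| * (‖x‖ ^ k * ‖f t x‖)) := by
        gcongr
        exact (h t ht x).trans (by gcongr; exact le_abs_self c)
    _ = |c| * (‖x‖ ^ (m + k) * ‖f t x‖) := by ring
    _ ≤ |c| * C := by gcongr; exact hC t ht x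

theorem RapidDecay.add {s : Set ι} {f g : ι → E → F} (hf : RapidDecay s f)
    (hg : RapidDecay s g) : RapidDecay s (fun t x => f t x + g t x) := by
  intro m
  obtain ⟨C, hC⟩ := hf m
  obtain ⟨D, hD⟩ := hg m
  refine ⟨C + D, fun t ht x => ?_⟩
  calc ‖x‖ ^ m * ‖f t x + g t x‖ ≤ ‖x‖ ^ m * (‖f t x‖ + ‖g t x‖) := by
        gcongr; exact norm_add_le _ _
    _ ≤ C + D := by rw [mul_add]; exact add_le_add (hC t ht x) (hD t ht x)

variable [NormedSpace ℝ E] [FiniteDimensional ℝ E] [Nontrivial E] [MeasurableSpace E]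
  [BorelSpace E] (μ : Measure E) [μ.IsAddHaarMeasure]

theorem integrable_norm_rpow_mul_inv {b : ℝ} (hb0 : 0 ≤ b) (hb : b < finrank ℝ E) :
    Integrable (fun x : E => ‖x‖ ^ (-b) * (1 + ‖x‖ ^ (finrank ℝ E + 1))⁻¹) μ := by
  refine (integrable_fun_norm_addHaar μ
    (f := fun r : ℝ => r ^ (-b) * (1 + r ^ (finrank ℝ E + 1))⁻¹)).2 ?_
  set n := finrank ℝ E with hn
  have hnpos : 0 < n := Module.finrank_pos
  have hmeas : Measurable fun y : ℝ => y ^ (n - 1) • (y ^ (-b) * (1 + y ^ (n + 1))⁻¹) := by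
    fun_prop
  have hpow : ∀ y : ℝ, 0 < y → y ^ (n - 1) * y ^ (-b) = y ^ ((n : ℝ) - 1 - b) := by
    intro y hy
    rw [← Real.rpow_natCast, ← Real.rpow_add hy, Nat.cast_sub hnpos]
    congr 1
    push_cast
    ring
  rw [← Ioc_union_Ioi_eq_Ioi zero_le_one]
  refine IntegrableOn.union ?_ ?_
  · have h1 : IntegrableOn (fun y : ℝ => y ^ ((n : ℝ) - 1 - b)) (Ioc 0 1) :=
      (intervalIntegrable_iff_integrableOn_Ioc_of_le zero_le_one).1
        (intervalIntegral.intervalIntegrable_rpow' (by linarith))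
    refine h1.mono' hmeas.aestronglyMeasurable ?_
    refine (ae_restrict_iff' measurableSet_Ioc).2 (Filter.Eventually.of_forall fun y hy => ?_)
    have hy0 : 0 < y := hy.1
    rw [Real.norm_of_nonneg (by positivity), smul_eq_mul, ← mul_assoc, hpow y hy0]
    refine mul_le_of_le_one_right (by positivity) (inv_le_one_of_one_le₀ ?_)
    have : 0 ≤ y ^ (n + 1) := by positivity
    linarith
  · have h1 : IntegrableOn (fun y : ℝ => y ^ (-2 - b)) (Ioi 1) :=
      integrableOn_Ioi_rpow_of_lt (by linarith) one_pos
    refine h1.mono' hmeas.aestronglyMeasurable ?_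
    refine (ae_restrict_iff' measurableSet_Ioi).2 (Filter.Eventually.of_forall fun y hy => ?_)
    have hy0 : 0 < y := zero_lt_one.trans hy
    rw [Real.norm_of_nonneg (by positivity), smul_eq_mul, ← mul_assoc, hpow y hy0,
      ← div_eq_mul_inv, div_le_iff₀ (by positivity)]
    have h2 : y ^ ((n : ℝ) - 1 - b) = y ^ (-2 - b) * y ^ (n + 1) := by
      rw [← Real.rpow_natCast, ← Real.rpow_add hy0]
      congr 1
      push_cast
      ring
    rw [h2]
    gcongr
    linarith

theorem integrable_norm_rpow_smul [NormedSpace ℝ F] {b : ℝ} (hb0 : 0 ≤ b)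
    (hb : b < finrank ℝ E) {f : E → F} (hm : AEStronglyMeasurable f μ)
    (hf : RapidDecay univ fun _ : Unit => f) :
    Integrable (fun x : E => ‖x‖ ^ (-b) • f x) μ := by
  obtain ⟨C, hC0, hC⟩ := hf.exists_bound (finrank ℝ E + 1)
  have hw : AEStronglyMeasurable (fun x : E => ‖x‖ ^ (-b)) μ := by
    have : Measurable fun x : E => ‖x‖ ^ (-b) := by fun_prop
    exact this.aestronglyMeasurable
  refine ((integrable_norm_rpow_mul_inv μ hb0 hb).const_mul C).mono' (hw.smul hm)
    (Filter.Eventually.of_forall fun x => ?_)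
  rw [norm_smul, Real.norm_of_nonneg (by positivity)]
  calc ‖x‖ ^ (-b) * ‖f x‖ ≤ ‖x‖ ^ (-b) * (C * (1 + ‖x‖ ^ (finrank ℝ E + 1))⁻¹) := by
        gcongr; exact hC () (mem_univ _) x
    _ = _ := by ring

/-- Integration by parts for the Euler vector field against a homogeneous weight, proved by
differentiating the scaling relation of the integral. -/
theorem integral_norm_rpow_smul_fderiv_self [NormedSpace ℝ F] [CompleteSpace F]
    {b : ℝ} (hb0 : 0 ≤ b) (hb : b < finrank ℝ E)
    {h : E → F} (hc : ContDiff ℝ 1 h) (h0 : RapidDecay univ fun _ : Unit => h)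
    (h1 : RapidDecay univ fun _ : Unit => fderiv ℝ h) :
    ∫ x, ‖x‖ ^ (-b) • fderiv ℝ h x x ∂μ =
      (b - finrank ℝ E) • ∫ x, ‖x‖ ^ (-b) • h x ∂μ := by
  set n := finrank ℝ E with hn
  have hd : Differentiable ℝ h := hc.differentiable one_ne_zero
  have hw : Measurable fun x : E => ‖x‖ ^ (-b) := by fun_prop
  have hr : RapidDecay (Metric.ball (1 : ℝ) (1 / 2)) fun l x => fderiv ℝ h (l • x) x := by
    intro m
    obtain ⟨C, hC⟩ := h1 (m + 1)
    refine ⟨2 ^ (m + 1) * C, fun l hl x => ?_⟩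
    have hl' : 1 / 2 ≤ l := by
      rw [Metric.mem_ball, Real.dist_eq, abs_lt] at hl
      linarith
    have hx : ‖x‖ ≤ 2 * ‖l • x‖ := by
      rw [norm_smul, Real.norm_of_nonneg (by linarith)]
      nlinarith [norm_nonneg x]
    calc ‖x‖ ^ m * ‖fderiv ℝ h (l • x) x‖ ≤ ‖x‖ ^ m * (‖fderiv ℝ h (l • x)‖ * ‖x‖) := by
          gcongr; exact ContinuousLinearMap.le_opNorm _ _
      _ = ‖x‖ ^ (m + 1) * ‖fderiv ℝ h (l • x)‖ := by ring
      _ ≤ (2 * ‖l • x‖) ^ (m + 1) * ‖fderiv ℝ h (l • x)‖ := by gcongr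
      _ = 2 ^ (m + 1) * (‖l • x‖ ^ (m + 1) * ‖fderiv ℝ h (l • x)‖) := by ring
      _ ≤ 2 ^ (m + 1) * C := by gcongr; exact hC () (mem_univ _) _
  obtain ⟨C, hC0, hC⟩ := hr.exists_bound (n + 1)
  have key := hasDerivAt_integral_of_dominated_loc_of_deriv_le (μ := μ) (x₀ := (1 : ℝ))
    (F := fun l x => ‖x‖ ^ (-b) • h (l • x)) (F' := fun l x => ‖x‖ ^ (-b) • fderiv ℝ h (l • x) x)
    (bound := fun x => C * (‖x‖ ^ (-b) * (1 + ‖x‖ ^ (n + 1))⁻¹))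
    (Metric.ball_mem_nhds (1 : ℝ) (by norm_num : (0 : ℝ) < 1 / 2)) ?_ ?_ ?_ ?_
    ((integrable_norm_rpow_mul_inv μ hb0 hb).const_mul C) ?_
  · have hG := key.2
    have hev : (fun l : ℝ => ∫ x, ‖x‖ ^ (-b) • h (l • x) ∂μ) =ᶠ[nhds 1]
        fun l => l ^ (b - n) • ∫ x, ‖x‖ ^ (-b) • h x ∂μ := by
      filter_upwards [lt_mem_nhds (zero_lt_one : (0 : ℝ) < 1)] with l hl
      have h2 := Measure.integral_comp_smul_of_nonneg μ (fun x => ‖x‖ ^ (-b) • h x) l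
        (hR := hl.le)
      have h3 : ∀ x, ‖x‖ ^ (-b) • h (l • x) = l ^ b • (‖l • x‖ ^ (-b) • h (l • x)) := by
        intro x
        rw [norm_smul, Real.norm_of_nonneg hl.le, Real.mul_rpow hl.le (norm_nonneg x), smul_smul,
          ← mul_assoc, ← Real.rpow_add hl]
        simp
      simp_rw [h3]
      rw [integral_smul, h2, smul_smul]
      congr 1
      rw [← Real.rpow_natCast, ← Real.rpow_neg hl.le, ← Real.rpow_add hl]
      rfl
    have hG2 : HasDerivAt (fun l : ℝ => l ^ (b - n) • ∫ x, ‖x‖ ^ (-b) • h x ∂μ)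
        (((b - n) * (1 : ℝ) ^ (b - n - 1)) • ∫ x, ‖x‖ ^ (-b) • h x ∂μ) 1 :=
      (Real.hasDerivAt_rpow_const (Or.inl one_ne_zero)).smul_const _
    have := (hG.congr_of_eventuallyEq hev.symm).unique hG2
    simpa using this
  · refine Filter.Eventually.of_forall fun l => hw.aestronglyMeasurable.smul ?_
    exact (hd.continuous.comp (continuous_const_smul l)).aestronglyMeasurable
  · simpa using integrable_norm_rpow_smul μ hb0 hb hd.continuous.aestronglyMeasurable h0
  · refine hw.aestronglyMeasurable.smul (Continuous.aestronglyMeasurable ?_)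
    exact (hc.continuous_fderiv one_ne_zero |>.comp (continuous_const_smul (1 : ℝ))).clm_apply
      continuous_id
  · refine Filter.Eventually.of_forall fun x l hl => ?_
    rw [norm_smul, Real.norm_of_nonneg (by positivity)]
    calc ‖x‖ ^ (-b) * ‖fderiv ℝ h (l • x) x‖
        ≤ ‖x‖ ^ (-b) * (C * (1 + ‖x‖ ^ (n + 1))⁻¹) := by gcongr; exact hC l hl x
      _ = _ := by ring
  · refine Filter.Eventually.of_forall fun x l hl => ?_
    have h2 : HasDerivAt (fun l : ℝ => h (l • x)) (fderiv ℝ h (l • x) x) l := by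
      have := (hd (l • x)).hasFDerivAt.comp_hasDerivAt l ((hasDerivAt_id l).smul_const x)
      simpa [Function.comp_def] using this
    exact h2.const_smul _

end SingularWeights

section VirialIdentities

open scoped SchwartzMap
open Module (finrank)

section Decay

variable {E F : Type*} [NormedAddCommGroup E] [NormedSpace ℝ E] [NormedAddCommGroup F]
  [NormedSpace ℝ F]

theorem rapidDecay_schwartz (v : 𝓢(E, F)) : RapidDecay univ fun _ : Unit => (v : E → F) :=
  fun m => ⟨_, fun _ _ x => v.norm_pow_mul_le_seminorm ℝ m x⟩

theorem rapidDecay_fderiv_schwartz (v : 𝓢(E, F)) :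
    RapidDecay univ fun _ : Unit => fderiv ℝ v :=
  rapidDecay_schwartz (SchwartzMap.fderivCLM ℝ E F v)

theorem rapidDecay_norm_rpow (v : 𝓢(E, ℂ)) {q : ℝ} (hq : 1 < q) :
    RapidDecay univ fun _ : Unit => fun x => ‖v x‖ ^ q := by
  refine (rapidDecay_schwartz v).of_norm_le ((SchwartzMap.seminorm ℝ 0 0 v) ^ (q - 1)) 0 ?_
  intro _ _ x
  rw [Real.norm_of_nonneg (by positivity), pow_zero, one_mul]
  calc ‖v x‖ ^ q = ‖v x‖ ^ (q - 1) * ‖v x‖ := by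
        rw [← Real.rpow_add_one' (norm_nonneg _) (by linarith)]; simp
    _ ≤ _ := by
        gcongr
        exact v.norm_le_seminorm ℝ x

theorem rapidDecay_fderiv_norm_rpow (v : 𝓢(E, ℂ)) {q : ℝ} (hq : 1 < q) :
    RapidDecay univ fun _ : Unit => fderiv ℝ fun x => ‖v x‖ ^ q := by
  refine (rapidDecay_fderiv_schwartz v).of_norm_le
    (q * (SchwartzMap.seminorm ℝ 0 0 v) ^ (q - 1)) 0 ?_
  intro _ _ x
  rw [pow_zero, one_mul]
  refine (norm_fderiv_norm_rpow_le v.differentiable hq).trans ?_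
  gcongr
  exact v.norm_le_seminorm ℝ x

variable [FiniteDimensional ℝ E] [Nontrivial E] [MeasurableSpace E] [BorelSpace E]
  {μ : Measure E} [μ.IsAddHaarMeasure]

theorem integral_eulerDeriv [CompleteSpace F] (h : 𝓢(E, F)) :
    ∫ x, eulerDeriv h x ∂μ = -(finrank ℝ E : ℝ) • ∫ x, h x ∂μ := by
  have := integral_norm_rpow_smul_fderiv_self μ (b := 0) le_rfl
    (by exact_mod_cast Module.finrank_pos) (h.smooth 1) (rapidDecay_schwartz h)
    (rapidDecay_fderiv_schwartz h)
  simpa [eulerDeriv_apply] using this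

theorem integral_inner_eulerDeriv_left (v w : 𝓢(E, ℂ)) :
    ∫ x, inner ℝ (eulerDeriv v x) (w x) ∂μ =
      -∫ x, inner ℝ (v x) (eulerDeriv w x) ∂μ
        - finrank ℝ E * ∫ x, inner ℝ (v x) (w x) ∂μ := by
  have h1 := integral_eulerDeriv (μ := μ) (SchwartzMap.pairing innerBilin v w)
  have h2 : ∀ x, eulerDeriv (SchwartzMap.pairing innerBilin v w) x =
      inner ℝ (v x) (eulerDeriv w x) + inner ℝ (eulerDeriv v x) (w x) := by
    intro x
    have : HasFDerivAt (SchwartzMap.pairing innerBilin v w) _ x :=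
      (v.hasFDerivAt x).inner ℝ (w.hasFDerivAt x)
    rw [eulerDeriv_apply, this.fderiv]
    simp [eulerDeriv_apply]
  simp_rw [h2] at h1
  rw [integral_add (integrable_inner_schwartz _ _) (integrable_inner_schwartz _ _)] at h1
  simp only [SchwartzMap.pairing_apply_apply, innerBilin_apply, smul_eq_mul] at h1
  linarith

theorem integral_norm_rpow_mul_inner_eulerDeriv {b p : ℝ} (hb0 : 0 ≤ b) (hb : b < finrank ℝ E)
    (hp : 1 < p) (v : 𝓢(E, ℂ)) :
    (p + 1) * ∫ x, ‖x‖ ^ (-b) * (‖v x‖ ^ (p - 1) * inner ℝ (v x) (eulerDeriv v x)) ∂μ =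
      (b - finrank ℝ E) * ∫ x, ‖x‖ ^ (-b) * ‖v x‖ ^ (p + 1) ∂μ := by
  have hq : 1 < p + 1 := by linarith
  have h := integral_norm_rpow_smul_fderiv_self μ hb0 hb ((v.smooth 1).norm_rpow hq)
    (rapidDecay_norm_rpow v hq) (rapidDecay_fderiv_norm_rpow v hq)
  simp only [smul_eq_mul] at h
  rw [← h, ← integral_const_mul]
  congr 1
  ext x
  rw [v.differentiable.fderiv_norm_rpow hq]
  simp only [smul_apply, ContinuousLinearMap.comp_apply, innerSL_apply_apply,
    smul_eq_mul, eulerDeriv_apply]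
  rw [show p + 1 - 2 = p - 1 by ring]
  ring

end Decay

variable {N : ℕ}

theorem lap_eq_sum (v : 𝓢(EuclideanSpace ℝ (Fin N), ℂ)) (x : EuclideanSpace ℝ (Fin N)) :
    lap v x = ∑ i : Fin N, dirDeriv (EuclideanSpace.single i 1)
      (dirDeriv (EuclideanSpace.single i 1) v) x := rfl

theorem eulerDeriv_eq_sum (v : 𝓢(EuclideanSpace ℝ (Fin N), ℂ)) (x : EuclideanSpace ℝ (Fin N)) :
    eulerDeriv v x = ∑ i : Fin N, (x i : ℂ) * dirDeriv (EuclideanSpace.single i 1) v x := by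
  have hx : x = ∑ i : Fin N, x i • EuclideanSpace.single i (1 : ℝ) := by
    have := (EuclideanSpace.basisFun (Fin N) ℝ).sum_repr x
    simpa using this.symm
  exact (congrArg (fderiv ℝ v x) hx).trans (by simp [dirDeriv_apply])

theorem integral_inner_lap (v w : 𝓢(EuclideanSpace ℝ (Fin N), ℂ)) :
    ∫ x, inner ℝ (lap v x) (w x) = -∑ i : Fin N, ∫ x, inner ℝ
      (dirDeriv (EuclideanSpace.single i 1) v x) (dirDeriv (EuclideanSpace.single i 1) w x) := by
  simp_rw [lap_eq_sum, sum_inner]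
  rw [integral_finsetSum _ fun i _ => integrable_inner_schwartz _ _, ← Finset.sum_neg_distrib]
  exact Finset.sum_congr rfl fun i _ => integral_inner_dirDeriv_left _ _ _

theorem integral_gradNormSq (v : 𝓢(EuclideanSpace ℝ (Fin N), ℂ)) :
    ∫ x, gradNormSq v x = ∑ i : Fin N, ∫ x, inner ℝ
      (dirDeriv (EuclideanSpace.single i 1) v x) (dirDeriv (EuclideanSpace.single i 1) v x) := by
  rw [← integral_finsetSum _ fun i _ => integrable_inner_schwartz _ _]
  simp only [gradNormSq, real_inner_self_eq_norm_sq, dirDeriv_apply]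

theorem integral_inner_lap_self (v : 𝓢(EuclideanSpace ℝ (Fin N), ℂ)) :
    ∫ x, inner ℝ (lap v x) (v x) = -∫ x, gradNormSq v x := by
  rw [integral_inner_lap, integral_gradNormSq]

theorem integral_inner_lap_eulerDeriv [NeZero N] (v : 𝓢(EuclideanSpace ℝ (Fin N), ℂ)) :
    ∫ x, inner ℝ (lap v x) (eulerDeriv v x) = ((N : ℝ) / 2 - 1) * ∫ x, gradNormSq v x := by
  rw [integral_inner_lap, integral_gradNormSq, ← Finset.sum_neg_distrib, Finset.mul_sum]
  refine Finset.sum_congr rfl fun i _ => ?_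
  simp_rw [dirDeriv_eulerDeriv, inner_add_right]
  rw [integral_add (integrable_inner_schwartz _ _) (integrable_inner_schwartz _ _)]
  have h := integral_inner_eulerDeriv_left (μ := volume)
    (dirDeriv (EuclideanSpace.single i 1) v) (dirDeriv (EuclideanSpace.single i 1) v)
  rw [finrank_euclideanSpace_fin] at h
  have hc : ∀ w : 𝓢(EuclideanSpace ℝ (Fin N), ℂ),
      ∫ x, inner ℝ (eulerDeriv w x) (w x) = ∫ x, inner ℝ (w x) (eulerDeriv w x) := fun w =>
    integral_congr_ae (Filter.Eventually.of_forall fun x => real_inner_comm _ _)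
  rw [hc] at h
  linarith

/-- The function `x ↦ i ‖x‖² v(x)` as a Schwartz function. -/
def weightedI (v : 𝓢(EuclideanSpace ℝ (Fin N), ℂ)) : 𝓢(EuclideanSpace ℝ (Fin N), ℂ) :=
  SchwartzMap.smulLeftCLM ℂ (fun x : EuclideanSpace ℝ (Fin N) => ‖x‖ ^ 2) (Complex.I • v)

theorem weightedI_apply (v : 𝓢(EuclideanSpace ℝ (Fin N), ℂ)) (x : EuclideanSpace ℝ (Fin N)) :
    weightedI v x = (‖x‖ ^ 2) • (Complex.I * v x) := by
  rw [weightedI, SchwartzMap.smulLeftCLM_apply_apply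
    (Function.hasTemperateGrowth_norm_sq (H := EuclideanSpace ℝ (Fin N)))]
  simp

theorem inner_I_mul_self (c : ℝ) (z : ℂ) : inner ℝ z (c • (Complex.I * z)) = 0 := by
  simp [Complex.inner]
  ring

theorem dirDeriv_weightedI (v : 𝓢(EuclideanSpace ℝ (Fin N), ℂ)) (i : Fin N)
    (x : EuclideanSpace ℝ (Fin N)) :
    dirDeriv (EuclideanSpace.single i 1) (weightedI v) x =
      (‖x‖ ^ 2) • (Complex.I * dirDeriv (EuclideanSpace.single i 1) v x)
        + (2 * x i) • (Complex.I * v x) := by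
  have hsq : HasFDerivAt (fun y : EuclideanSpace ℝ (Fin N) => ‖y‖ ^ 2) (2 • innerSL ℝ x) x :=
    (hasStrictFDerivAt_norm_sq x).hasFDerivAt
  have h := (hsq.smul ((v.hasFDerivAt x).const_mul Complex.I)).congr_of_eventuallyEq
    (Filter.Eventually.of_forall fun y => weightedI_apply v y)
  rw [dirDeriv_apply, h.fderiv]
  simp [dirDeriv_apply, EuclideanSpace.inner_single_right]

theorem integral_inner_lap_weightedI (v : 𝓢(EuclideanSpace ℝ (Fin N), ℂ)) :
    ∫ x, inner ℝ (lap v x) (weightedI v x) =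
      -2 * ∫ x, inner ℝ (eulerDeriv v x) (Complex.I * v x) := by
  rw [integral_inner_lap, ← integral_finsetSum _ fun i _ => integrable_inner_schwartz _ _,
    ← integral_neg, ← integral_const_mul]
  congr 1
  ext x
  simp_rw [dirDeriv_weightedI, inner_add_right, inner_I_mul_self, eulerDeriv_eq_sum, zero_add,
    sum_inner]
  rw [Finset.mul_sum, ← Finset.sum_neg_distrib]
  refine Finset.sum_congr rfl fun i _ => ?_
  rw [real_inner_smul_right, ← Complex.real_smul, real_inner_smul_left]
  ring

theorem integrable_norm_rpow_mul_schwartz {b p : ℝ} [NeZero N] (hb0 : 0 ≤ b) (hb : b < N)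
    (hp : 1 < p) (v w : 𝓢(EuclideanSpace ℝ (Fin N), ℂ)) :
    Integrable (fun x : EuclideanSpace ℝ (Fin N) =>
      ‖x‖ ^ (-b) * (‖v x‖ ^ (p - 1) * inner ℝ (v x) (w x))) := by
  refine integrable_norm_rpow_smul volume (b := b) hb0 (by simpa using hb)
    (f := fun x : EuclideanSpace ℝ (Fin N) => ‖v x‖ ^ (p - 1) * inner ℝ (v x) (w x)) ?_ ?_
  · refine Continuous.aestronglyMeasurable ?_
    exact (v.continuous.norm.rpow_const fun x => Or.inr (by linarith)).mul
      (v.continuous.inner w.continuous)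
  · refine (rapidDecay_schwartz w).of_norm_le
      ((SchwartzMap.seminorm ℝ 0 0 v) ^ (p - 1) * SchwartzMap.seminorm ℝ 0 0 v) 0 ?_
    intro _ _ x
    have h1 := v.norm_le_seminorm ℝ x
    rw [pow_zero, one_mul, norm_mul, Real.norm_of_nonneg (by positivity), mul_assoc]
    gcongr
    exact (norm_inner_le_norm _ _).trans (by gcongr)

/-- The virial functional as the pairing of the stationary part of the equation with the
generator of scaling. -/
theorem integral_inner_generator {b p : ℝ} [NeZero N] (hb0 : 0 ≤ b) (hb : b < N) (hp : 1 < p)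
    (v : 𝓢(EuclideanSpace ℝ (Fin N), ℂ)) :
    ∫ x, inner ℝ (lap v x + ((‖x‖ ^ (-b) * ‖v x‖ ^ (p - 1) : ℝ) : ℂ) * v x)
      (2 * eulerDeriv v x + N * v x) = -2 * Kq N b p v := by
  have hpt : ∀ x, inner ℝ (lap v x + ((‖x‖ ^ (-b) * ‖v x‖ ^ (p - 1) : ℝ) : ℂ) * v x)
      (2 * eulerDeriv v x + N * v x) =
      (2 * inner ℝ (lap v x) (eulerDeriv v x) + N * inner ℝ (lap v x) (v x)) +
      (2 * (‖x‖ ^ (-b) * (‖v x‖ ^ (p - 1) * inner ℝ (v x) (eulerDeriv v x))) +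
        N * (‖x‖ ^ (-b) * (‖v x‖ ^ (p - 1) * inner ℝ (v x) (v x)))) := by
    intro x
    have h2 : (2 * eulerDeriv v x + N * v x : ℂ) = (2 : ℝ) • eulerDeriv v x + (N : ℝ) • v x := by
      simp
    rw [h2, ← Complex.real_smul]
    simp only [inner_add_left, inner_add_right, real_inner_smul_left, real_inner_smul_right]
    ring
  have hv : ∀ x, ‖x‖ ^ (-b) * (‖v x‖ ^ (p - 1) * inner ℝ (v x) (v x)) =
      ‖x‖ ^ (-b) * ‖v x‖ ^ (p + 1) := by
    intro x
    rw [real_inner_self_eq_norm_sq, ← Real.rpow_natCast ‖v x‖ 2,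
      ← Real.rpow_add' (norm_nonneg _) (by push_cast; linarith)]
    congr 2
    push_cast
    ring
  have i1 : Integrable (fun x => inner ℝ (lap v x) (eulerDeriv v x)) := by
    simp_rw [lap_eq_sum, sum_inner]
    exact integrable_finsetSum _ fun i _ => integrable_inner_schwartz _ _
  have i2 : Integrable (fun x => inner ℝ (lap v x) (v x)) := by
    simp_rw [lap_eq_sum, sum_inner]
    exact integrable_finsetSum _ fun i _ => integrable_inner_schwartz _ _
  have i3 := integrable_norm_rpow_mul_schwartz hb0 hb hp v (eulerDeriv v)
  have i4 := integrable_norm_rpow_mul_schwartz hb0 hb hp v v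
  simp_rw [hpt]
  have i12 : Integrable fun x => 2 * inner ℝ (lap v x) (eulerDeriv v x) +
      N * inner ℝ (lap v x) (v x) := (i1.const_mul 2).add (i2.const_mul _)
  have i34 : Integrable fun x : EuclideanSpace ℝ (Fin N) =>
      2 * (‖x‖ ^ (-b) * (‖v x‖ ^ (p - 1) * inner ℝ (v x) (eulerDeriv v x))) +
      N * (‖x‖ ^ (-b) * (‖v x‖ ^ (p - 1) * inner ℝ (v x) (v x))) :=
    (i3.const_mul 2).add (i4.const_mul _)
  rw [integral_add i12 i34, integral_add (i1.const_mul 2) (i2.const_mul _),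
    integral_add (i3.const_mul 2) (i4.const_mul _)]
  simp only [integral_const_mul]
  have h3 := integral_norm_rpow_mul_inner_eulerDeriv (μ := volume) hb0
    (by simpa using hb) hp v
  rw [finrank_euclideanSpace_fin] at h3
  simp_rw [hv]
  rw [integral_inner_lap_eulerDeriv, integral_inner_lap_self, Kq]
  have hp1 : p + 1 ≠ 0 := by linarith
  rw [mul_comm, ← eq_div_iff hp1] at h3
  rw [h3]
  field_simp
  ring

end VirialIdentities

section TimeDerivative

open scoped SchwartzMap Topology
open Filter

theorem Set.OrdConnected.exists_Icc_mem_nhdsWithin {J : Set ℝ} (hJ : J.OrdConnected) {s : ℝ}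
    (hs : s ∈ J) : ∃ a c, s ∈ Icc a c ∧ Icc a c ⊆ J ∧ Icc a c ∈ 𝓝[J] s := by
  have hl : ∃ a ∈ J, a ≤ s ∧ ∀ᶠ t in 𝓝[J] s, a ≤ t := by
    by_cases h : ∃ a ∈ J, a < s
    · obtain ⟨a, ha, has⟩ := h
      exact ⟨a, ha, has.le, nhdsWithin_le_nhds (le_mem_nhds has)⟩
    · push Not at h
      exact ⟨s, hs, le_rfl, eventually_nhdsWithin_of_forall h⟩
  have hr : ∃ c ∈ J, s ≤ c ∧ ∀ᶠ t in 𝓝[J] s, t ≤ c := by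
    by_cases h : ∃ c ∈ J, s < c
    · obtain ⟨c, hc, hsc⟩ := h
      exact ⟨c, hc, hsc.le, nhdsWithin_le_nhds (ge_mem_nhds hsc)⟩
    · push Not at h
      exact ⟨s, hs, le_rfl, eventually_nhdsWithin_of_forall h⟩
  obtain ⟨a, ha, has, hl⟩ := hl
  obtain ⟨c, hc, hsc, hr⟩ := hr
  exact ⟨a, c, ⟨has, hsc⟩, hJ.out ha hc, hl.and hr⟩

theorem Set.OrdConnected.uniqueDiffOn_of_nontrivial {J : Set ℝ} (hJ : J.OrdConnected)
    (h : J.Nontrivial) : UniqueDiffOn ℝ J := by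
  obtain ⟨a, ha, c, hc, hac⟩ := h.exists_lt
  refine uniqueDiffOn_convex hJ.convex ⟨(a + c) / 2, ?_⟩
  rw [mem_interior_iff_mem_nhds]
  exact mem_of_superset (Icc_mem_nhds (by linarith) (by linarith)) (hJ.out ha hc)

theorem norm_lap_le {N : ℕ} (v : 𝓢(EuclideanSpace ℝ (Fin N), ℂ)) (x : EuclideanSpace ℝ (Fin N)) :
    ‖lap v x‖ ≤ N * ‖iteratedFDeriv ℝ 2 v x‖ := by
  have h : ∀ i : Fin N, ‖dirDeriv (EuclideanSpace.single i 1)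
      (dirDeriv (EuclideanSpace.single i 1) v) x‖ ≤ ‖iteratedFDeriv ℝ 2 v x‖ := by
    intro i
    have h2 : HasFDerivAt (fderiv ℝ v) (fderiv ℝ (fderiv ℝ v) x) x :=
      (SchwartzMap.fderivCLM ℝ _ ℂ v).hasFDerivAt x
    have h3 : HasFDerivAt (dirDeriv (EuclideanSpace.single i 1) v) _ x :=
      h2.clm_apply (hasFDerivAt_const (EuclideanSpace.single i (1 : ℝ)) x)
    rw [dirDeriv_apply, h3.fderiv, ← norm_iteratedFDeriv_fderiv, norm_iteratedFDeriv_one]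
    simp only [ContinuousLinearMap.comp_zero, zero_add, ContinuousLinearMap.flip_apply]
    refine (ContinuousLinearMap.le_opNorm₂ _ _ _).trans ?_
    simp
  rw [lap_eq_sum]
  refine (norm_sum_le _ _).trans ((Finset.sum_le_sum fun i _ => h i).trans ?_)
  simp

namespace INLSSolution

variable {N : ℕ} {b p : ℝ} {J : Set ℝ} (sol : INLSSolution N b p J)

/-- The stationary part `Δu + |x|^{-b} |u|^{p-1} u` of the equation. -/
def stationary (t : ℝ) (x : EuclideanSpace ℝ (Fin N)) : ℂ :=
  lap (sol.u t) x + ((‖x‖ ^ (-b) * ‖sol.u t x‖ ^ (p - 1) : ℝ) : ℂ) * sol.u t x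

theorem hasDerivWithinAt {t : ℝ} (ht : t ∈ J) {x : EuclideanSpace ℝ (Fin N)} (hx : x ≠ 0) :
    HasDerivWithinAt (fun s => sol.u s x) (Complex.I * sol.stationary t x) J t := by
  obtain ⟨u', h1, h2⟩ := sol.eqn t ht x hx
  convert h1 using 1
  have h3 : Complex.I * u' + sol.stationary t x = 0 := by rw [← h2, stationary]; ring
  linear_combination Complex.I * h3 - u' * Complex.I_sq

theorem rapidDecay_iteratedFDeriv {K : Set ℝ} (hK : K ⊆ J) (hc : IsCompact K) (n : ℕ) :
    RapidDecay K fun t => iteratedFDeriv ℝ n (sol.u t) := by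
  intro m
  obtain ⟨C, hC⟩ := sol.seminorm_bound K hK hc m n
  exact ⟨C, fun t ht x => ((sol.u t).le_seminorm ℝ m n x).trans (hC t ht)⟩

theorem rapidDecay {K : Set ℝ} (hK : K ⊆ J) (hc : IsCompact K) :
    RapidDecay K fun t => (sol.u t : EuclideanSpace ℝ (Fin N) → ℂ) :=
  (sol.rapidDecay_iteratedFDeriv hK hc 0).of_norm_le 1 0 fun t _ x => by simp

theorem rapidDecay_eulerDeriv {K : Set ℝ} (hK : K ⊆ J) (hc : IsCompact K) :
    RapidDecay K fun t => (eulerDeriv (sol.u t) : EuclideanSpace ℝ (Fin N) → ℂ) :=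
  (sol.rapidDecay_iteratedFDeriv hK hc 1).of_norm_le 1 1 fun t _ x => by
    rw [eulerDeriv_apply, norm_iteratedFDeriv_one, one_mul, pow_one, mul_comm]
    exact ContinuousLinearMap.le_opNorm _ _

theorem exists_norm_stationary_le (hp : 1 < p) {K : Set ℝ} (hK : K ⊆ J) (hc : IsCompact K) :
    ∃ C : ℝ, 0 ≤ C ∧ ∀ t ∈ K, ∀ x, ‖sol.stationary t x‖ ≤ C * (1 + ‖x‖ ^ (-b)) := by
  obtain ⟨C, hC⟩ := sol.rapidDecay_iteratedFDeriv hK hc 2 0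
  obtain ⟨D, hD⟩ := sol.rapidDecay hK hc 0
  refine ⟨max (N * C) 0 + (max D 0) ^ p, by positivity, fun t ht x => ?_⟩
  have h1 := hC t ht x
  have h2 := hD t ht x
  simp only [pow_zero, one_mul] at h1 h2
  have hb : 0 ≤ ‖x‖ ^ (-b) := by positivity
  have h3 : ‖lap (sol.u t) x‖ ≤ max (N * C) 0 :=
    (norm_lap_le _ _).trans ((by gcongr : _ ≤ N * C).trans (le_max_left _ _))
  have h4 : ‖((‖x‖ ^ (-b) * ‖sol.u t x‖ ^ (p - 1) : ℝ) : ℂ) * sol.u t x‖ ≤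
      ‖x‖ ^ (-b) * (max D 0) ^ p := by
    rw [norm_mul, Complex.norm_real, Real.norm_of_nonneg (by positivity), mul_assoc,
      ← Real.rpow_add_one' (norm_nonneg _) (by linarith), sub_add_cancel]
    gcongr
    exact h2.trans (le_max_left _ _)
  refine (norm_add_le _ _).trans ((add_le_add h3 h4).trans ?_)
  have h5 : 0 ≤ max (N * C) 0 := le_max_right _ _
  have h6 : 0 ≤ (max D 0) ^ p := by positivity
  nlinarith

theorem exists_norm_sub_le (hp : 1 < p) {a c : ℝ} (hK : Icc a c ⊆ J) :
    ∃ C : ℝ, 0 ≤ C ∧ ∀ s ∈ Icc a c, ∀ t ∈ Icc a c, ∀ x : EuclideanSpace ℝ (Fin N), x ≠ 0 →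
      ‖sol.u t x - sol.u s x‖ ≤ C * (1 + ‖x‖ ^ (-b)) * ‖t - s‖ := by
  obtain ⟨C, hC0, hC⟩ := sol.exists_norm_stationary_le hp hK isCompact_Icc
  refine ⟨C, hC0, fun s hs t ht x hx => ?_⟩
  refine (convex_Icc a c).norm_image_sub_le_of_norm_hasDerivWithin_le
    (f := fun r => sol.u r x) (fun r hr => (sol.hasDerivWithinAt (hK hr) hx).mono hK) ?_ hs ht
  intro r hr
  simpa using hC r hr x

theorem tendsto_apply {s : ℝ} (hs : s ∈ J) (x : EuclideanSpace ℝ (Fin N)) :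
    Tendsto (fun t => sol.u t x) (𝓝[J] s) (𝓝 (sol.u s x)) := by
  have h := sol.cont (s, x) ⟨hs, mem_univ _⟩
  have h2 : ContinuousWithinAt (fun t : ℝ => (t, x)) J s :=
    (Continuous.prodMk_left x).continuousWithinAt
  exact ContinuousWithinAt.comp (f := fun t : ℝ => (t, x)) (x := s)
    (g := fun q : ℝ × EuclideanSpace ℝ (Fin N) => sol.u q.1 q.2) h h2 fun t ht => ⟨ht, mem_univ _⟩

theorem tendsto_fderiv (hJ : J.OrdConnected) {s : ℝ} (hs : s ∈ J)
    {x : EuclideanSpace ℝ (Fin N)} (hx : x ≠ 0) :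
    Tendsto (fun t => fderiv ℝ (sol.u t) x) (𝓝[J] s) (𝓝 (fderiv ℝ (sol.u s) x)) := by
  rcases J.subsingleton_or_nontrivial with h | h
  · have hJs : 𝓝[J] s = pure s := by rw [h.eq_singleton_of_mem hs, nhdsWithin_singleton]
    rw [hJs]
    exact tendsto_pure_nhds _ _
  set S : Set (ℝ × EuclideanSpace ℝ (Fin N)) := J ×ˢ {x : EuclideanSpace ℝ (Fin N) | x ≠ 0}
  have hop : IsOpen {x : EuclideanSpace ℝ (Fin N) | x ≠ 0} := isOpen_ne
  have hU : UniqueDiffOn ℝ S := (hJ.uniqueDiffOn_of_nontrivial h).prod hop.uniqueDiffOn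
  set f : ℝ × EuclideanSpace ℝ (Fin N) → ℂ := fun q => sol.u q.1 q.2
  have hcont : ContinuousOn (fderivWithin ℝ f S) S :=
    sol.smooth.continuousOn_fderivWithin hU (by simp)
  have heq : ∀ t ∈ J, fderiv ℝ (sol.u t) x =
      (fderivWithin ℝ f S (t, x)).comp (ContinuousLinearMap.inr ℝ ℝ _) := by
    intro t ht
    have h1 : HasFDerivWithinAt f (fderivWithin ℝ f S (t, x)) S (t, x) :=
      (sol.smooth.differentiableOn (by simp) (t, x) ⟨ht, hx⟩).hasFDerivWithinAt
    have h2 : HasFDerivWithinAt (fun y : EuclideanSpace ℝ (Fin N) => (t, y))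
        (ContinuousLinearMap.inr ℝ ℝ _) {x | x ≠ 0} x :=
      (hasFDerivAt_prodMk_right t x).hasFDerivWithinAt
    have h3 := h1.comp x h2 fun y hy => ⟨ht, hy⟩
    exact (h3.hasFDerivAt (hop.mem_nhds hx)).fderiv
  have h1 : ContinuousWithinAt (fun t : ℝ => fderivWithin ℝ f S (t, x)) J s :=
    ContinuousWithinAt.comp (f := fun t : ℝ => (t, x)) (x := s) (t := S) (hcont (s, x) ⟨hs, hx⟩)
      (Continuous.prodMk_left x).continuousWithinAt fun t ht => ⟨ht, hx⟩
  have h2 : ContinuousWithinAt (fun t : ℝ => fderiv ℝ (sol.u t) x) J s :=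
    (h1.clm_comp continuousWithinAt_const).congr heq (heq s hs)
  exact h2

/-- A functional whose increments are pairings of the increments of the solution with rapidly
decaying weights is differentiable, the time derivative being replaced by the equation. -/
theorem hasDerivWithinAt_of_sub_eq [NeZero N] (hb0 : 0 ≤ b) (hb : b < N) (hp : 1 < p) {a c s : ℝ}
    (hs : s ∈ Icc a c) (hK : Icc a c ⊆ J) (hn : Icc a c ∈ 𝓝[J] s)
    {w : ℝ → EuclideanSpace ℝ (Fin N) → ℂ} (hw : RapidDecay (Icc a c) w)
    (hwc : ∀ t, Continuous (w t))
    (hwt : ∀ x ≠ 0, Tendsto (fun t => w t x) (𝓝[J] s) (𝓝 (w s x)))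
    {Φ : ℝ → ℝ} (hΦ : ∀ t, Φ t - Φ s = ∫ x, inner ℝ (sol.u t x - sol.u s x) (w t x)) :
    HasDerivWithinAt Φ (∫ x, inner ℝ (Complex.I * sol.stationary s x) (w s x)) J s := by
  obtain ⟨C, hC0, hC⟩ := sol.exists_norm_sub_le hp hK
  obtain ⟨D, hD0, hD⟩ := hw.exists_bound (N + 1)
  have hle : 𝓝[J \ {s}] s ≤ 𝓝[J] s := nhdsWithin_mono _ sdiff_subset
  have hne : ∀ᵐ x : EuclideanSpace ℝ (Fin N), x ≠ 0 := by
    simp [ae_iff]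
  have hslope : slope Φ s = fun t =>
      ∫ x, inner ℝ (slope (fun r => sol.u r x) s t) (w t x) := by
    ext t
    simp only [slope_def_module, hΦ, real_inner_smul_left, integral_const_mul, smul_eq_mul]
  rw [hasDerivWithinAt_iff_tendsto_slope, hslope]
  refine tendsto_integral_filter_of_dominated_convergence
    (fun x => C * D * (‖x‖ ^ (-(0 : ℝ)) * (1 + ‖x‖ ^ (N + 1))⁻¹) +
      C * D * (‖x‖ ^ (-b) * (1 + ‖x‖ ^ (N + 1))⁻¹)) ?_ ?_ ?_ ?_
  · refine Eventually.of_forall fun t => Continuous.aestronglyMeasurable ?_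
    simp only [slope_def_module]
    exact (((sol.u t).continuous.sub (sol.u s).continuous).const_smul _).inner (hwc t)
  · filter_upwards [hle hn, self_mem_nhdsWithin] with t ht hts
    filter_upwards [hne] with x hx
    have hts' : 0 < ‖t - s‖ := norm_pos_iff.2 (sub_ne_zero.2 hts.2)
    have h1 : ‖slope (fun r => sol.u r x) s t‖ ≤ C * (1 + ‖x‖ ^ (-b)) := by
      rw [slope_def_module, norm_smul, norm_inv, inv_mul_le_iff₀ hts', mul_comm]
      exact hC s hs t ht x hx
    calc _ ≤ ‖slope (fun r => sol.u r x) s t‖ * ‖w t x‖ := norm_inner_le_norm _ _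
      _ ≤ (C * (1 + ‖x‖ ^ (-b))) * (D * (1 + ‖x‖ ^ (N + 1))⁻¹) := by
          gcongr
          exact hD t ht x
      _ = _ := by simp; ring
  · have h0 := integrable_norm_rpow_mul_inv (volume : Measure (EuclideanSpace ℝ (Fin N)))
      le_rfl (by simpa using NeZero.pos N)
    have h1 := integrable_norm_rpow_mul_inv (volume : Measure (EuclideanSpace ℝ (Fin N)))
      hb0 (by simpa using hb)
    rw [finrank_euclideanSpace_fin] at h0 h1
    exact (h0.const_mul _).add (h1.const_mul _)
  · filter_upwards [hne] with x hx
    exact ((hasDerivWithinAt_iff_tendsto_slope.1 (sol.hasDerivWithinAt (hK hs) hx))).inner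
      ((hwt x hx).mono_left hle)

theorem hasDerivWithinAt_variance [NeZero N] (hb0 : 0 ≤ b) (hb : b < N) (hp : 1 < p)
    (hJ : J.OrdConnected) {s : ℝ} (hs : s ∈ J) :
    HasDerivWithinAt (fun t => ∫ x : EuclideanSpace ℝ (Fin N), ‖x‖ ^ 2 * ‖sol.u t x‖ ^ 2)
      (4 * ∫ x, inner ℝ (eulerDeriv (sol.u s) x) (Complex.I * sol.u s x)) J s := by
  obtain ⟨a, c, hsK, hK, hn⟩ := hJ.exists_Icc_mem_nhdsWithin hs
  have hI : ∀ t, Integrable fun x : EuclideanSpace ℝ (Fin N) => ‖x‖ ^ 2 * ‖sol.u t x‖ ^ 2 := by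
    intro t
    refine (integrable_inner_schwartz (SchwartzMap.smulLeftCLM ℂ
      (fun x : EuclideanSpace ℝ (Fin N) => ‖x‖ ^ 2) (sol.u t)) (sol.u t)).congr
      (Eventually.of_forall fun x => ?_)
    simp only []
    rw [SchwartzMap.smulLeftCLM_apply_apply (Function.hasTemperateGrowth_norm_sq
      (H := EuclideanSpace ℝ (Fin N))), real_inner_smul_left, real_inner_self_eq_norm_sq]
  have hd := sol.hasDerivWithinAt_of_sub_eq hb0 hb hp hsK hK hn
    (w := fun t x => (‖x‖ ^ 2) • (sol.u t x + sol.u s x)) ?_ ?_ ?_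
    (Φ := fun t => ∫ x : EuclideanSpace ℝ (Fin N), ‖x‖ ^ 2 * ‖sol.u t x‖ ^ 2) ?_
  · convert hd using 1
    have h := integral_inner_lap_weightedI (sol.u s)
    have h2 : ∀ x, inner ℝ (Complex.I * sol.stationary s x)
        ((‖x‖ ^ 2) • (sol.u s x + sol.u s x)) =
        -2 * inner ℝ (lap (sol.u s) x) (weightedI (sol.u s) x) := by
      intro x
      rw [weightedI_apply, stationary]
      generalize ‖x‖ ^ (-b) * ‖sol.u s x‖ ^ (p - 1) = r
      generalize lap (sol.u s) x = l
      generalize ‖x‖ ^ 2 = q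
      simp [Complex.inner]
      ring
    simp_rw [h2]
    rw [integral_const_mul, h]
    ring
  · have h1 := sol.rapidDecay hK isCompact_Icc
    have h2 : RapidDecay (Icc a c) fun _ : ℝ => (sol.u s : EuclideanSpace ℝ (Fin N) → ℂ) :=
      fun m => (h1 m).imp fun C hC t _ x => hC s hsK x
    exact (h1.add h2).of_norm_le 1 2 fun t _ x => by rw [norm_smul]; simp
  · intro t
    have := (sol.u t).continuous
    have := (sol.u s).continuous
    fun_prop
  · intro x _
    exact ((sol.tendsto_apply hs x).add tendsto_const_nhds).const_smul _
  · intro t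
    rw [← integral_sub (hI t) (hI s)]
    congr 1
    ext x
    rw [real_inner_smul_right, inner_sub_left, inner_add_right, inner_add_right,
      real_inner_comm (sol.u t x) (sol.u s x), real_inner_self_eq_norm_sq,
      real_inner_self_eq_norm_sq]
    ring

theorem hasDerivWithinAt_momentum [NeZero N] (hb0 : 0 ≤ b) (hb : b < N) (hp : 1 < p)
    (hJ : J.OrdConnected) {s : ℝ} (hs : s ∈ J) :
    HasDerivWithinAt (fun t => ∫ x, inner ℝ (eulerDeriv (sol.u t) x) (Complex.I * sol.u t x))
      (2 * Kq N b p (sol.u s)) J s := by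
  obtain ⟨a, c, hsK, hK, hn⟩ := hJ.exists_Icc_mem_nhdsWithin hs
  have hd := sol.hasDerivWithinAt_of_sub_eq hb0 hb hp hsK hK hn
    (w := fun t x => -(Complex.I * (eulerDeriv (sol.u t) x +
      (eulerDeriv (sol.u s) x + N * sol.u s x)))) ?_ ?_ ?_
    (Φ := fun t => ∫ x, inner ℝ (eulerDeriv (sol.u t) x) (Complex.I * sol.u t x)) ?_
  · convert hd using 1
    have h := integral_inner_generator hb0 hb hp (sol.u s)
    have h2 : ∀ x, inner ℝ (Complex.I * sol.stationary s x)
        (-(Complex.I * (eulerDeriv (sol.u s) x + (eulerDeriv (sol.u s) x + N * sol.u s x)))) =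
        -inner ℝ (lap (sol.u s) x + ((‖x‖ ^ (-b) * ‖sol.u s x‖ ^ (p - 1) : ℝ) : ℂ) * sol.u s x)
          (2 * eulerDeriv (sol.u s) x + N * sol.u s x) := by
      intro x
      rw [stationary]
      generalize lap (sol.u s) x + _ = l
      simp [Complex.inner]
      ring
    simp_rw [h2]
    rw [integral_neg, h]
    ring
  · have h1 := sol.rapidDecay hK isCompact_Icc
    have h2 := sol.rapidDecay_eulerDeriv hK isCompact_Icc
    have h3 : RapidDecay (Icc a c) fun _ : ℝ => (sol.u s : EuclideanSpace ℝ (Fin N) → ℂ) :=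
      fun m => (h1 m).imp fun C hC t _ x => hC s hsK x
    have h4 : RapidDecay (Icc a c) fun _ : ℝ =>
        (eulerDeriv (sol.u s) : EuclideanSpace ℝ (Fin N) → ℂ) :=
      fun m => (h2 m).imp fun C hC t _ x => hC s hsK x
    have h5 : RapidDecay (Icc a c) fun (_ : ℝ) x => (N : ℂ) * sol.u s x :=
      h3.of_norm_le N 0 fun t _ x => by simp
    exact (h2.add (h4.add h5)).of_norm_le 1 0 fun t _ x => by simp
  · intro t
    have := (sol.u s).continuous
    have := (eulerDeriv (sol.u t)).continuous
    have := (eulerDeriv (sol.u s)).continuous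
    fun_prop
  · intro x hx
    have h1 : Tendsto (fun t => eulerDeriv (sol.u t) x) (𝓝[J] s)
        (𝓝 (eulerDeriv (sol.u s) x)) :=
      ((ContinuousLinearMap.apply ℝ ℂ x).continuous.tendsto _).comp (sol.tendsto_fderiv hJ hs hx)
    exact ((h1.add tendsto_const_nhds).const_mul _).neg
  · intro t
    set v := sol.u t
    set u := sol.u s
    have hE : eulerDeriv (v - u) = eulerDeriv v - eulerDeriv u := by simp [eulerDeriv]
    have h := integral_inner_eulerDeriv_left (μ := volume) (v - u) (Complex.I • u)
    rw [finrank_euclideanSpace_fin, hE] at h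
    have hEI : eulerDeriv (Complex.I • u) = Complex.I • eulerDeriv u := by
      ext x
      have hd : HasFDerivAt (Complex.I • u : 𝓢(EuclideanSpace ℝ (Fin N), ℂ))
          (Complex.I • fderiv ℝ u x) x := (u.hasFDerivAt x).const_smul Complex.I
      rw [eulerDeriv_apply, hd.fderiv]
      rfl
    rw [hEI] at h
    have i1 := integrable_inner_schwartz (μ := volume) (eulerDeriv v) (Complex.I • v)
    have i2 := integrable_inner_schwartz (μ := volume) (eulerDeriv u) (Complex.I • u)
    have i3 := integrable_inner_schwartz (μ := volume) (eulerDeriv v) (Complex.I • (v - u))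
    have i4 := integrable_inner_schwartz (μ := volume) (eulerDeriv v - eulerDeriv u)
      (Complex.I • u)
    have i5 := integrable_inner_schwartz (μ := volume) (v - u) (Complex.I • eulerDeriv u)
    have i6 := integrable_inner_schwartz (μ := volume) (v - u) (Complex.I • u)
    simp only [sub_apply, smul_apply, smul_eq_mul] at h i1 i2 i3 i4 i5 i6
    have e1 : ∀ x, inner ℝ (v x - u x)
        (-(Complex.I * (eulerDeriv v x + (eulerDeriv u x + N * u x)))) =
        inner ℝ (eulerDeriv v x) (Complex.I * (v x - u x)) +
        (-inner ℝ (v x - u x) (Complex.I * eulerDeriv u x) -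
          N * inner ℝ (v x - u x) (Complex.I * u x)) := by
      intro x
      simp [Complex.inner]
      ring
    have i5n : Integrable fun x => -inner ℝ (v x - u x) (Complex.I * eulerDeriv u x) := i5.neg
    have i56 : Integrable fun x => -inner ℝ (v x - u x) (Complex.I * eulerDeriv u x) -
          N * inner ℝ (v x - u x) (Complex.I * u x) := i5n.sub (i6.const_mul _)
    have e2 : ∀ x, inner ℝ (eulerDeriv v x) (Complex.I * v x) -
        inner ℝ (eulerDeriv u x) (Complex.I * u x) =
        inner ℝ (eulerDeriv v x) (Complex.I * (v x - u x)) +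
        inner ℝ (eulerDeriv v x - eulerDeriv u x) (Complex.I * u x) := by
      intro x
      simp only [mul_sub, inner_sub_right, inner_sub_left]
      ring
    simp_rw [e1]
    rw [← integral_sub i1 i2]
    simp_rw [e2]
    rw [integral_add i3 i4, integral_add i3 i56, h, integral_sub i5n (i6.const_mul _),
      integral_neg, integral_const_mul]

end INLSSolution

end TimeDerivative

/-- The virial identity: for a classical Schwartz solution of (INLS) on an
interval `J`, the variance `t ↦ ∫ |x|²|u(t,x)|² dx` is twice differentiable on `J` and its
second derivative equals `8 K(u(t,·))`, where
`K(v) = ∫|∇v|² − ((N(p−1)+2b)/(2(p+1))) ∫ |x|^{-b}|v|^{p+1}`. -/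
theorem stmt14 (N : ℕ) (hN : 1 ≤ N) (b p : ℝ) (hb1 : 0 < b) (hb2 : b < min 2 (N : ℝ))
    (hp : 1 < p) (J : Set ℝ) (hJ : J.OrdConnected) (sol : INLSSolution N b p J) :
    ∃ I' : ℝ → ℝ,
      (∀ t ∈ J,
        HasDerivWithinAt
          (fun s => ∫ x : EuclideanSpace ℝ (Fin N), ‖x‖ ^ 2 * ‖sol.u s x‖ ^ 2) (I' t) J t) ∧
      (∀ t ∈ J, HasDerivWithinAt I' (8 * Kq N b p (fun y => sol.u t y)) J t) := by
  have : NeZero N := ⟨by omega⟩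
  have hb : b < N := hb2.trans_le (min_le_right _ _)
  refine ⟨fun t => 4 * ∫ x, inner ℝ (eulerDeriv (sol.u t) x) (Complex.I * sol.u t x),
    fun t ht => sol.hasDerivWithinAt_variance hb1.le hb hp hJ ht, fun t ht => ?_⟩
  have h := (sol.hasDerivWithinAt_momentum hb1.le hb hp hJ ht).const_mul 4
  rwa [← mul_assoc, show (4 : ℝ) * 2 = 8 by norm_num] at h
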